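/- Let H be a Hopf algebra with bijective antipode, B a bialgebra in the category of Yetter–Drinfeld modules over H, K a subalgebra of B, and I a Yetter–Drinfeld submodule of K that is a coideal of B, an ideal of K, and satisfies Δ(K) ⊆ K⊗K + I⊗B. Then the quotient K/I inherits a bialgebra structure in the category of Yetter–Drinfeld modules over H, with comultiplication induced from Δ. -/

import Mathlib

set_option synthInstance.maxHeartbeats 1000000
set_option maxHeartbeats 2000000

open TensorProduct

section YetterDrinfeld

variable (k H M : Type*) [CommRing k] [Ring H] [HopfAlgebra k H]
  [AddCommGroup M] [Module k M]

/-- The braiding `c(x ⊗ y) = (x₍₋₁₎ · y) ⊗ x₍₀₎` of the category of Yetter–Drinfeld modules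
over `H`, on a module `M` with action `act` and coaction `coact`. -/
noncomputable def ydBraiding (act : H →ₗ[k] M →ₗ[k] M) (coact : M →ₗ[k] H ⊗[k] M) :
    M ⊗[k] M →ₗ[k] M ⊗[k] M :=
  LinearMap.rTensor M (TensorProduct.lift act)
    ∘ₗ (TensorProduct.assoc k H M M).symm.toLinearMap
    ∘ₗ LinearMap.lTensor H (TensorProduct.comm k M M).toLinearMap
    ∘ₗ (TensorProduct.assoc k H M M).toLinearMap
    ∘ₗ LinearMap.rTensor M coact

/-- The map `id ⊗ c ⊗ id : (M ⊗ M) ⊗ (M ⊗ M) → (M ⊗ M) ⊗ (M ⊗ M)`. -/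
noncomputable def midTwist (c : M ⊗[k] M →ₗ[k] M ⊗[k] M) :
    (M ⊗[k] M) ⊗[k] (M ⊗[k] M) →ₗ[k] (M ⊗[k] M) ⊗[k] (M ⊗[k] M) :=
  (TensorProduct.assoc k M M (M ⊗[k] M)).symm.toLinearMap
    ∘ₗ LinearMap.lTensor M (TensorProduct.assoc k M M M).toLinearMap
    ∘ₗ LinearMap.lTensor M (LinearMap.rTensor M c)
    ∘ₗ LinearMap.lTensor M (TensorProduct.assoc k M M M).symm.toLinearMap
    ∘ₗ (TensorProduct.assoc k M M (M ⊗[k] M)).toLinearMap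

/-- The right-hand side `h ⊗ m ↦ (h₍₁₎ m₍₋₁₎ S(h₍₃₎)) ⊗ (h₍₂₎ · m₍₀₎)` of the
Yetter–Drinfeld compatibility condition. -/
noncomputable def ydCompatRHS (act : H →ₗ[k] M →ₗ[k] M) (coact : M →ₗ[k] H ⊗[k] M) :
    H ⊗[k] M →ₗ[k] H ⊗[k] M :=
  TensorProduct.map (LinearMap.mul' k H) (TensorProduct.lift act)
    ∘ₗ (TensorProduct.tensorTensorTensorComm k H H H M).toLinearMap
    ∘ₗ LinearMap.lTensor (H ⊗[k] H)
        (LinearMap.rTensor M (LinearMap.mul' k H)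
          ∘ₗ LinearMap.rTensor M (TensorProduct.comm k H H).toLinearMap
          ∘ₗ (TensorProduct.assoc k H H M).symm.toLinearMap)
    ∘ₗ (TensorProduct.assoc k (H ⊗[k] H) H (H ⊗[k] M)).toLinearMap
    ∘ₗ LinearMap.rTensor (H ⊗[k] M)
        (LinearMap.lTensor (H ⊗[k] H) (HopfAlgebra.antipode (R := k) (A := H)))
    ∘ₗ LinearMap.lTensor ((H ⊗[k] H) ⊗[k] H) coact
    ∘ₗ LinearMap.rTensor M (LinearMap.rTensor H (Coalgebra.comul (R := k) (A := H)))
    ∘ₗ LinearMap.rTensor M (Coalgebra.comul (R := k) (A := H))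

/-- A bialgebra in the braided monoidal category of Yetter–Drinfeld modules over the Hopf
algebra `H`: an `H`-Yetter–Drinfeld module `M` which is simultaneously an algebra and a
coalgebra in the category, the comultiplication being multiplicative with respect to the
braided multiplication on `M ⊗ M`. -/
structure YDBialgebra : Type _ where
  mul : M →ₗ[k] M →ₗ[k] M
  one : M
  comul : M →ₗ[k] M ⊗[k] M
  counit : M →ₗ[k] k
  act : H →ₗ[k] M →ₗ[k] M
  coact : M →ₗ[k] H ⊗[k] M
  mul_assoc' : ∀ x y z, mul (mul x y) z = mul x (mul y z)
  one_mul' : ∀ x, mul one x = x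
  mul_one' : ∀ x, mul x one = x
  act_one' : ∀ x, act 1 x = x
  act_mul' : ∀ g h x, act (g * h) x = act g (act h x)
  coassoc' : (TensorProduct.assoc k M M M).toLinearMap ∘ₗ LinearMap.rTensor M comul ∘ₗ comul
      = LinearMap.lTensor M comul ∘ₗ comul
  counit_comul_left : ∀ x, (TensorProduct.lid k M) (LinearMap.rTensor M counit (comul x)) = x
  counit_comul_right : ∀ x, (TensorProduct.rid k M) (LinearMap.lTensor M counit (comul x)) = x
  coact_coassoc : LinearMap.rTensor M (Coalgebra.comul (R := k) (A := H)) ∘ₗ coact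
      = (TensorProduct.assoc k H H M).symm.toLinearMap ∘ₗ LinearMap.lTensor H coact ∘ₗ coact
  coact_counit :
    ∀ x, (TensorProduct.lid k M)
        (LinearMap.rTensor M (Coalgebra.counit (R := k) (A := H)) (coact x)) = x
  yd_compat : coact ∘ₗ TensorProduct.lift act = ydCompatRHS k H M act coact
  act_algebra : TensorProduct.lift act ∘ₗ LinearMap.lTensor H (TensorProduct.lift mul)
      = TensorProduct.lift mul
          ∘ₗ TensorProduct.map (TensorProduct.lift act) (TensorProduct.lift act)
          ∘ₗ (TensorProduct.tensorTensorTensorComm k H H M M).toLinearMap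
          ∘ₗ LinearMap.rTensor (M ⊗[k] M) (Coalgebra.comul (R := k) (A := H))
  act_one_elem : ∀ h, act h one = Coalgebra.counit (R := k) h • one
  coact_algebra : coact ∘ₗ TensorProduct.lift mul
      = TensorProduct.map (LinearMap.mul' k H) (TensorProduct.lift mul)
          ∘ₗ (TensorProduct.tensorTensorTensorComm k H M H M).toLinearMap
          ∘ₗ TensorProduct.map coact coact
  coact_one : coact one = (1 : H) ⊗ₜ[k] one
  act_comul : comul ∘ₗ TensorProduct.lift act
      = TensorProduct.map (TensorProduct.lift act) (TensorProduct.lift act)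
          ∘ₗ (TensorProduct.tensorTensorTensorComm k H H M M).toLinearMap
          ∘ₗ LinearMap.lTensor (H ⊗[k] H) comul
          ∘ₗ LinearMap.rTensor M (Coalgebra.comul (R := k) (A := H))
  act_counit : ∀ h x, counit (act h x) = Coalgebra.counit (R := k) h * counit x
  coact_comul : LinearMap.lTensor H comul ∘ₗ coact
      = LinearMap.rTensor (M ⊗[k] M) (LinearMap.mul' k H)
          ∘ₗ (TensorProduct.tensorTensorTensorComm k H M H M).toLinearMap
          ∘ₗ TensorProduct.map coact coact ∘ₗ comul
  coact_counit_elem : ∀ x, LinearMap.lTensor H counit (coact x)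
      = counit x • ((1 : H) ⊗ₜ[k] (1 : k))
  counit_mul : ∀ x y, counit (mul x y) = counit x * counit y
  comul_one : comul one = one ⊗ₜ[k] one
  counit_one : counit one = 1
  braided_comul_mul : comul ∘ₗ TensorProduct.lift mul
      = TensorProduct.map (TensorProduct.lift mul) (TensorProduct.lift mul)
          ∘ₗ midTwist k M (ydBraiding k H M act coact)
          ∘ₗ TensorProduct.map comul comul

end YetterDrinfeld

section Factor

variable {k A C X : Type*} [CommRing k] [AddCommGroup A] [Module k A] [AddCommGroup C]
  [Module k C] [AddCommGroup X] [Module k X]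

theorem exists_lift_of_injective (f : A →ₗ[k] C) (hf : Function.Injective f) (g : X →ₗ[k] C)
    (h : ∀ x, g x ∈ LinearMap.range f) : ∃ l : X →ₗ[k] A, ∀ x, f (l x) = g x := by
  refine ⟨(LinearEquiv.ofInjective f hf).symm.toLinearMap ∘ₗ g.codRestrict _ h, fun x => ?_⟩
  simp

theorem exists_desc_of_surjective (f : A →ₗ[k] C) (hf : Function.Surjective f) (g : A →ₗ[k] X)
    (h : ∀ a, f a = 0 → g a = 0) : ∃ l : C →ₗ[k] X, ∀ a, l (f a) = g a := by
  refine ⟨(LinearMap.ker f).liftQ g (fun a ha => h a ha) ∘ₗ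
    (f.quotKerEquivOfSurjective hf).symm.toLinearMap, fun a => ?_⟩
  have : (f.quotKerEquivOfSurjective hf).symm (f a) = (LinearMap.ker f).mkQ a := by
    rw [LinearEquiv.symm_apply_eq]; rfl
  simp only [LinearMap.comp_apply, LinearEquiv.coe_coe, this]
  rfl

end Factor

section Transfer

variable {k X Y X' Y' : Type*} [CommRing k] [AddCommGroup X] [Module k X] [AddCommGroup Y]
  [Module k Y] [AddCommGroup X'] [Module k X'] [AddCommGroup Y'] [Module k Y']
  {a : X →ₗ[k] X'} {b : Y →ₗ[k] Y'} {L R : X →ₗ[k] Y} {L' R' : X' →ₗ[k] Y'}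

theorem eq_of_surjective_of_natural (ha : Function.Surjective a) (hL : ∀ x, b (L x) = L' (a x))
    (hR : ∀ x, b (R x) = R' (a x)) (h : L = R) : L' = R' := by
  ext y
  obtain ⟨x, rfl⟩ := ha y
  rw [← hL, ← hR, h]

theorem eq_of_injective_of_natural (hb : Function.Injective b) (hL : ∀ x, b (L x) = L' (a x))
    (hR : ∀ x, b (R x) = R' (a x)) (h : L' = R') : L = R := by
  ext x
  exact hb (by rw [hL, hR, h])

end Transfer

section Naturality

variable {k H M N : Type*} [CommRing k] [Ring H] [HopfAlgebra k H]
  [AddCommGroup M] [Module k M] [AddCommGroup N] [Module k N] {f : M →ₗ[k] N}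
  {mulM : M →ₗ[k] M →ₗ[k] M} {mulN : N →ₗ[k] N →ₗ[k] N}
  {comulM : M →ₗ[k] M ⊗[k] M} {comulN : N →ₗ[k] N ⊗[k] N}
  {counitM : M →ₗ[k] k} {counitN : N →ₗ[k] k}
  {actM : H →ₗ[k] M →ₗ[k] M} {actN : H →ₗ[k] N →ₗ[k] N}
  {coactM : M →ₗ[k] H ⊗[k] M} {coactN : N →ₗ[k] H ⊗[k] N}

theorem coassoc_left_natural (hc : ∀ x, map f f (comulM x) = comulN (f x)) (x : M) :
    map f (map f f)
        (((TensorProduct.assoc k M M M).toLinearMap ∘ₗ LinearMap.rTensor M comulM ∘ₗ comulM) x)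
      = ((TensorProduct.assoc k N N N).toLinearMap ∘ₗ LinearMap.rTensor N comulN ∘ₗ comulN)
          (f x) := by
  simp only [LinearMap.comp_apply, LinearEquiv.coe_coe, ← hc]
  induction comulM x with
  | zero => simp
  | add u v hu hv => simp only [map_add, hu, hv]
  | tmul u v =>
    simp only [LinearMap.rTensor_tmul, map_tmul, ← hc]
    induction comulM u with
    | zero => simp
    | add u v hu hv => simp only [map_add, add_tmul, hu, hv]
    | tmul u v => simp

theorem coassoc_right_natural (hc : ∀ x, map f f (comulM x) = comulN (f x)) (x : M) :
    map f (map f f) ((LinearMap.lTensor M comulM ∘ₗ comulM) x)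
      = (LinearMap.lTensor N comulN ∘ₗ comulN) (f x) := by
  simp only [LinearMap.comp_apply, ← hc]
  induction comulM x with
  | zero => simp
  | add u v hu hv => simp only [map_add, hu, hv]
  | tmul u v => simp [hc]

theorem counit_left_natural (hc : ∀ x, map f f (comulM x) = comulN (f x))
    (he : ∀ x, counitM x = counitN (f x)) (x : M) :
    f ((TensorProduct.lid k M) (LinearMap.rTensor M counitM (comulM x)))
      = (TensorProduct.lid k N) (LinearMap.rTensor N counitN (comulN (f x))) := by
  rw [← hc]
  induction comulM x with
  | zero => simp
  | add u v hu hv => simp only [map_add, hu, hv]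
  | tmul u v => simp [he]

theorem counit_right_natural (hc : ∀ x, map f f (comulM x) = comulN (f x))
    (he : ∀ x, counitM x = counitN (f x)) (x : M) :
    f ((TensorProduct.rid k M) (LinearMap.lTensor M counitM (comulM x)))
      = (TensorProduct.rid k N) (LinearMap.lTensor N counitN (comulN (f x))) := by
  rw [← hc]
  induction comulM x with
  | zero => simp
  | add u v hu hv => simp only [map_add, hu, hv]
  | tmul u v => simp [he]

theorem coact_coassoc_left_natural
    (hd : ∀ x, LinearMap.lTensor H f (coactM x) = coactN (f x)) (x : M) :
    LinearMap.lTensor (H ⊗[k] H) f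
        ((LinearMap.rTensor M (Coalgebra.comul (R := k) (A := H)) ∘ₗ coactM) x)
      = (LinearMap.rTensor N (Coalgebra.comul (R := k) (A := H)) ∘ₗ coactN) (f x) := by
  simp only [LinearMap.comp_apply, ← hd]
  induction coactM x with
  | zero => simp
  | add u v hu hv => simp only [map_add, hu, hv]
  | tmul u v => simp

theorem coact_coassoc_right_natural
    (hd : ∀ x, LinearMap.lTensor H f (coactM x) = coactN (f x)) (x : M) :
    LinearMap.lTensor (H ⊗[k] H) f (((TensorProduct.assoc k H H M).symm.toLinearMap
        ∘ₗ LinearMap.lTensor H coactM ∘ₗ coactM) x)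
      = ((TensorProduct.assoc k H H N).symm.toLinearMap
        ∘ₗ LinearMap.lTensor H coactN ∘ₗ coactN) (f x) := by
  simp only [LinearMap.comp_apply, LinearEquiv.coe_coe, ← hd]
  induction coactM x with
  | zero => simp
  | add u v hu hv => simp only [map_add, hu, hv]
  | tmul u v =>
    simp only [LinearMap.lTensor_tmul, ← hd]
    induction coactM v with
    | zero => simp
    | add u v hu hv => simp only [map_add, tmul_add, hu, hv]
    | tmul u v => simp

theorem coact_counit_natural
    (hd : ∀ x, LinearMap.lTensor H f (coactM x) = coactN (f x)) (x : M) :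
    f ((TensorProduct.lid k M)
        (LinearMap.rTensor M (Coalgebra.counit (R := k) (A := H)) (coactM x)))
      = (TensorProduct.lid k N)
        (LinearMap.rTensor N (Coalgebra.counit (R := k) (A := H)) (coactN (f x))) := by
  rw [← hd]
  induction coactM x with
  | zero => simp
  | add u v hu hv => simp only [map_add, hu, hv]
  | tmul u v => simp

theorem coact_act_natural (ha : ∀ h x, f (actM h x) = actN h (f x))
    (hd : ∀ x, LinearMap.lTensor H f (coactM x) = coactN (f x)) (x : H ⊗[k] M) :
    LinearMap.lTensor H f ((coactM ∘ₗ TensorProduct.lift actM) x)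
      = (coactN ∘ₗ TensorProduct.lift actN) (LinearMap.lTensor H f x) := by
  induction x with
  | zero => simp
  | add u v hu hv => simp only [map_add, hu, hv]
  | tmul u v => simp [ha, hd]

theorem ydCompatRHS_natural (ha : ∀ h x, f (actM h x) = actN h (f x))
    (hd : ∀ x, LinearMap.lTensor H f (coactM x) = coactN (f x)) (x : H ⊗[k] M) :
    LinearMap.lTensor H f (ydCompatRHS k H M actM coactM x)
      = ydCompatRHS k H N actN coactN (LinearMap.lTensor H f x) := by
  simp only [ydCompatRHS, LinearMap.comp_apply, LinearEquiv.coe_coe]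
  induction x with
  | zero => simp
  | add u v hu hv => simp only [map_add, hu, hv]
  | tmul h v =>
    simp only [LinearMap.lTensor_tmul, LinearMap.rTensor_tmul]
    induction LinearMap.rTensor H (Coalgebra.comul (R := k) (A := H))
        (Coalgebra.comul (R := k) h) with
    | zero => simp
    | add u v hu hv => simp only [map_add, add_tmul, hu, hv]
    | tmul g g' =>
      simp only [LinearMap.lTensor_tmul, ← hd]
      induction coactM v with
      | zero => simp
      | add u v hu hv => simp only [map_add, tmul_add, hu, hv]
      | tmul u v =>
        induction g with
        | zero => simp
        | add u v hu hv => simp only [map_add, add_tmul, hu, hv]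
        | tmul g₁ g₂ => simp [ha]

theorem act_mul_natural (hm : ∀ x y, f (mulM x y) = mulN (f x) (f y))
    (ha : ∀ h x, f (actM h x) = actN h (f x)) (x : H ⊗[k] (M ⊗[k] M)) :
    f ((TensorProduct.lift actM ∘ₗ LinearMap.lTensor H (TensorProduct.lift mulM)) x)
      = (TensorProduct.lift actN ∘ₗ LinearMap.lTensor H (TensorProduct.lift mulN))
          (LinearMap.lTensor H (map f f) x) := by
  induction x with
  | zero => simp
  | add u v hu hv => simp only [map_add, hu, hv]
  | tmul h v =>
    induction v with
    | zero => simp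
    | add u v hu hv => simp only [map_add, tmul_add, hu, hv]
    | tmul u v => simp [ha, hm]

theorem mul_act_natural (hm : ∀ x y, f (mulM x y) = mulN (f x) (f y))
    (ha : ∀ h x, f (actM h x) = actN h (f x)) (x : H ⊗[k] (M ⊗[k] M)) :
    f ((TensorProduct.lift mulM
          ∘ₗ TensorProduct.map (TensorProduct.lift actM) (TensorProduct.lift actM)
          ∘ₗ (TensorProduct.tensorTensorTensorComm k H H M M).toLinearMap
          ∘ₗ LinearMap.rTensor (M ⊗[k] M) (Coalgebra.comul (R := k) (A := H))) x)
      = (TensorProduct.lift mulN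
          ∘ₗ TensorProduct.map (TensorProduct.lift actN) (TensorProduct.lift actN)
          ∘ₗ (TensorProduct.tensorTensorTensorComm k H H N N).toLinearMap
          ∘ₗ LinearMap.rTensor (N ⊗[k] N) (Coalgebra.comul (R := k) (A := H)))
          (LinearMap.lTensor H (map f f) x) := by
  simp only [LinearMap.comp_apply, LinearEquiv.coe_coe]
  induction x with
  | zero => simp
  | add u v hu hv => simp only [map_add, hu, hv]
  | tmul h v =>
    simp only [LinearMap.lTensor_tmul, LinearMap.rTensor_tmul]
    induction Coalgebra.comul (R := k) h with
    | zero => simp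
    | add u v hu hv => simp only [map_add, add_tmul, hu, hv]
    | tmul g g' =>
      induction v with
      | zero => simp
      | add u v hu hv => simp only [map_add, tmul_add, hu, hv]
      | tmul u v => simp [ha, hm]

theorem coact_mul_natural (hm : ∀ x y, f (mulM x y) = mulN (f x) (f y))
    (hd : ∀ x, LinearMap.lTensor H f (coactM x) = coactN (f x)) (x : M ⊗[k] M) :
    LinearMap.lTensor H f ((coactM ∘ₗ TensorProduct.lift mulM) x)
      = (coactN ∘ₗ TensorProduct.lift mulN) (map f f x) := by
  induction x with
  | zero => simp
  | add u v hu hv => simp only [map_add, hu, hv]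
  | tmul u v => simp [hm, hd]

theorem mul_coact_natural (hm : ∀ x y, f (mulM x y) = mulN (f x) (f y))
    (hd : ∀ x, LinearMap.lTensor H f (coactM x) = coactN (f x)) (x : M ⊗[k] M) :
    LinearMap.lTensor H f
        ((TensorProduct.map (LinearMap.mul' k H) (TensorProduct.lift mulM)
          ∘ₗ (TensorProduct.tensorTensorTensorComm k H M H M).toLinearMap
          ∘ₗ TensorProduct.map coactM coactM) x)
      = (TensorProduct.map (LinearMap.mul' k H) (TensorProduct.lift mulN)
          ∘ₗ (TensorProduct.tensorTensorTensorComm k H N H N).toLinearMap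
          ∘ₗ TensorProduct.map coactN coactN) (map f f x) := by
  simp only [LinearMap.comp_apply, LinearEquiv.coe_coe]
  induction x with
  | zero => simp
  | add u v hu hv => simp only [map_add, hu, hv]
  | tmul u v =>
    simp only [map_tmul, ← hd]
    induction coactM u with
    | zero => simp
    | add u v hu hv => simp only [map_add, add_tmul, hu, hv]
    | tmul g u =>
      induction coactM v with
      | zero => simp
      | add u v hu hv => simp only [map_add, tmul_add, hu, hv]
      | tmul g' v => simp [hm]

theorem comul_act_natural (hc : ∀ x, map f f (comulM x) = comulN (f x))
    (ha : ∀ h x, f (actM h x) = actN h (f x)) (x : H ⊗[k] M) :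
    map f f ((comulM ∘ₗ TensorProduct.lift actM) x)
      = (comulN ∘ₗ TensorProduct.lift actN) (LinearMap.lTensor H f x) := by
  induction x with
  | zero => simp
  | add u v hu hv => simp only [map_add, hu, hv]
  | tmul u v => simp [hc, ha]

theorem act_comul_natural (hc : ∀ x, map f f (comulM x) = comulN (f x))
    (ha : ∀ h x, f (actM h x) = actN h (f x)) (x : H ⊗[k] M) :
    map f f ((TensorProduct.map (TensorProduct.lift actM) (TensorProduct.lift actM)
          ∘ₗ (TensorProduct.tensorTensorTensorComm k H H M M).toLinearMap
          ∘ₗ LinearMap.lTensor (H ⊗[k] H) comulM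
          ∘ₗ LinearMap.rTensor M (Coalgebra.comul (R := k) (A := H))) x)
      = (TensorProduct.map (TensorProduct.lift actN) (TensorProduct.lift actN)
          ∘ₗ (TensorProduct.tensorTensorTensorComm k H H N N).toLinearMap
          ∘ₗ LinearMap.lTensor (H ⊗[k] H) comulN
          ∘ₗ LinearMap.rTensor N (Coalgebra.comul (R := k) (A := H)))
          (LinearMap.lTensor H f x) := by
  simp only [LinearMap.comp_apply, LinearEquiv.coe_coe]
  induction x with
  | zero => simp
  | add u v hu hv => simp only [map_add, hu, hv]
  | tmul h v =>
    simp only [LinearMap.lTensor_tmul, LinearMap.rTensor_tmul, ← hc]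
    induction Coalgebra.comul (R := k) h with
    | zero => simp
    | add u v hu hv => simp only [map_add, add_tmul, hu, hv]
    | tmul g g' =>
      induction comulM v with
      | zero => simp
      | add u v hu hv => simp only [map_add, tmul_add, hu, hv]
      | tmul u v => simp [ha]

theorem comul_coact_natural (hc : ∀ x, map f f (comulM x) = comulN (f x))
    (hd : ∀ x, LinearMap.lTensor H f (coactM x) = coactN (f x)) (x : M) :
    LinearMap.lTensor H (map f f) ((LinearMap.lTensor H comulM ∘ₗ coactM) x)
      = (LinearMap.lTensor H comulN ∘ₗ coactN) (f x) := by
  simp only [LinearMap.comp_apply, ← hd]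
  induction coactM x with
  | zero => simp
  | add u v hu hv => simp only [map_add, hu, hv]
  | tmul u v => simp [hc]

theorem coact_comul_natural (hc : ∀ x, map f f (comulM x) = comulN (f x))
    (hd : ∀ x, LinearMap.lTensor H f (coactM x) = coactN (f x)) (x : M) :
    LinearMap.lTensor H (map f f)
        ((LinearMap.rTensor (M ⊗[k] M) (LinearMap.mul' k H)
          ∘ₗ (TensorProduct.tensorTensorTensorComm k H M H M).toLinearMap
          ∘ₗ TensorProduct.map coactM coactM ∘ₗ comulM) x)
      = (LinearMap.rTensor (N ⊗[k] N) (LinearMap.mul' k H)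
          ∘ₗ (TensorProduct.tensorTensorTensorComm k H N H N).toLinearMap
          ∘ₗ TensorProduct.map coactN coactN ∘ₗ comulN) (f x) := by
  simp only [LinearMap.comp_apply, LinearEquiv.coe_coe, ← hc]
  induction comulM x with
  | zero => simp
  | add u v hu hv => simp only [map_add, hu, hv]
  | tmul u v =>
    simp only [map_tmul, ← hd]
    induction coactM u with
    | zero => simp
    | add u v hu hv => simp only [map_add, add_tmul, hu, hv]
    | tmul g u =>
      induction coactM v with
      | zero => simp
      | add u v hu hv => simp only [map_add, tmul_add, hu, hv]
      | tmul g' v => simp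

theorem coact_counit_elem_natural (he : ∀ x, counitM x = counitN (f x))
    (hd : ∀ x, LinearMap.lTensor H f (coactM x) = coactN (f x)) (x : M) :
    LinearMap.lTensor H counitM (coactM x) = LinearMap.lTensor H counitN (coactN (f x)) := by
  rw [← hd]
  induction coactM x with
  | zero => simp
  | add u v hu hv => simp only [map_add, hu, hv]
  | tmul u v => simp [he]

variable (mulM actM coactM) in
/-- The multiplication of `M ⊗ M` twisted by the Yetter–Drinfeld braiding. -/
noncomputable def ydTensorMul : (M ⊗[k] M) ⊗[k] (M ⊗[k] M) →ₗ[k] M ⊗[k] M :=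
  TensorProduct.map (TensorProduct.lift mulM) (TensorProduct.lift mulM)
    ∘ₗ midTwist k M (ydBraiding k H M actM coactM)

variable (mulM actM coactM) in
theorem ydTensorMul_tmul (a b c d : M) :
    ydTensorMul mulM actM coactM ((a ⊗ₜ b) ⊗ₜ (c ⊗ₜ d))
      = map (mulM a ∘ₗ actM.flip c) (mulM.flip d) (coactM b) := by
  simp only [ydTensorMul, midTwist, ydBraiding, LinearMap.comp_apply, LinearEquiv.coe_coe,
    assoc_tmul, LinearMap.lTensor_tmul, assoc_symm_tmul, LinearMap.rTensor_tmul]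
  induction coactM b with
  | zero => simp
  | add u v hu hv => simp only [map_add, add_tmul, tmul_add, hu, hv]
  | tmul g u => simp

theorem ydTensorMul_natural (hm : ∀ x y, f (mulM x y) = mulN (f x) (f y))
    (ha : ∀ h x, f (actM h x) = actN h (f x))
    (hd : ∀ x, LinearMap.lTensor H f (coactM x) = coactN (f x)) (u v : M ⊗[k] M) :
    map f f (ydTensorMul mulM actM coactM (u ⊗ₜ v))
      = ydTensorMul mulN actN coactN (map f f u ⊗ₜ map f f v) := by
  induction u with
  | zero => simp
  | add u v hu hv => simp only [map_add, add_tmul, hu, hv]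
  | tmul a b =>
    induction v with
    | zero => simp
    | add u v hu hv => simp only [map_add, tmul_add, hu, hv]
    | tmul c d =>
      simp only [map_tmul, ydTensorMul_tmul, ← hd]
      induction coactM b with
      | zero => simp
      | add u v hu hv => simp only [map_add, hu, hv]
      | tmul g w => simp [hm, ha]

variable (mulM actM coactM) in
theorem ydTensorMul_mem_range_rTensor (P Q R : Submodule k M)
    (h : ∀ a ∈ P, ∀ g, ∀ c ∈ Q, mulM a (actM g c) ∈ R) {u v : M ⊗[k] M}
    (hu : u ∈ LinearMap.range (LinearMap.rTensor M P.subtype))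
    (hv : v ∈ LinearMap.range (LinearMap.rTensor M Q.subtype)) :
    ydTensorMul mulM actM coactM (u ⊗ₜ v) ∈ LinearMap.range (LinearMap.rTensor M R.subtype) := by
  obtain ⟨u, rfl⟩ := hu
  obtain ⟨v, rfl⟩ := hv
  induction u with
  | zero => simp
  | add u v hu hv =>
    simp only [map_add, add_tmul]
    exact add_mem hu hv
  | tmul a b =>
    induction v with
    | zero => simp
    | add u v hu hv =>
      simp only [map_add, tmul_add]
      exact add_mem hu hv
    | tmul c d =>
      simp only [LinearMap.rTensor_tmul, ydTensorMul_tmul]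
      induction coactM b with
      | zero => simp
      | add u v hu hv =>
        rw [map_add]
        exact add_mem hu hv
      | tmul g w => exact ⟨⟨_, h a a.2 g c c.2⟩ ⊗ₜ mulM w d, by simp⟩

end Naturality

section Quotient

theorem TensorProduct.map_injective_of_field {k A A' C C' : Type*} [Field k] [AddCommGroup A]
    [Module k A] [AddCommGroup A'] [Module k A'] [AddCommGroup C] [Module k C] [AddCommGroup C']
    [Module k C'] {f : A →ₗ[k] A'} {g : C →ₗ[k] C'} (hf : Function.Injective f)
    (hg : Function.Injective g) : Function.Injective (map f g) := by
  rw [← LinearMap.lTensor_comp_rTensor, LinearMap.coe_comp]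
  exact (Module.Flat.lTensor_preserves_injective_linearMap g hg).comp
    (Module.Flat.rTensor_preserves_injective_linearMap f hf)

variable {k H B K V Q : Type*} [Field k] [Ring H] [HopfAlgebra k H]
  [AddCommGroup B] [Module k B] [AddCommGroup K] [Module k K]
  [AddCommGroup V] [Module k V] [AddCommGroup Q] [Module k Q]

/-- A Yetter–Drinfeld bialgebra structure on `Q`, where `Q` is both a quotient of the subalgebra
`K` of `B` and a subcoalgebra of the quotient `V` of `B`. -/
noncomputable def YDBialgebra.ofSubquotient (S : YDBialgebra k H B)
    {j : K →ₗ[k] B} {p : K →ₗ[k] Q} {π : B →ₗ[k] V} {ι : Q →ₗ[k] V}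
    (hj : Function.Injective j) (hp : Function.Surjective p)
    (hπ : Function.Surjective π) (hι : Function.Injective ι) (hιp : ∀ x, ι (p x) = π (j x))
    {mulK : K →ₗ[k] K →ₗ[k] K} {oneK : K} {actK : H →ₗ[k] K →ₗ[k] K} {coactK : K →ₗ[k] H ⊗[k] K}
    {comulV : V →ₗ[k] V ⊗[k] V} {counitV : V →ₗ[k] k}
    {actV : H →ₗ[k] V →ₗ[k] V} {coactV : V →ₗ[k] H ⊗[k] V}
    (mulQ : Q →ₗ[k] Q →ₗ[k] Q) (comulQ : Q →ₗ[k] Q ⊗[k] Q)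
    (actQ : H →ₗ[k] Q →ₗ[k] Q) (coactQ : Q →ₗ[k] H ⊗[k] Q)
    (mul_j : ∀ x y, j (mulK x y) = S.mul (j x) (j y)) (one_j : j oneK = S.one)
    (act_j : ∀ h x, j (actK h x) = S.act h (j x))
    (coact_j : ∀ x, LinearMap.lTensor H j (coactK x) = S.coact (j x))
    (mul_p : ∀ x y, p (mulK x y) = mulQ (p x) (p y))
    (act_p : ∀ h x, p (actK h x) = actQ h (p x))
    (coact_p : ∀ x, LinearMap.lTensor H p (coactK x) = coactQ (p x))
    (comul_π : ∀ x, map π π (S.comul x) = comulV (π x))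
    (counit_π : ∀ x, S.counit x = counitV (π x))
    (act_π : ∀ h x, π (S.act h x) = actV h (π x))
    (coact_π : ∀ x, LinearMap.lTensor H π (S.coact x) = coactV (π x))
    (comul_ι : ∀ x, map ι ι (comulQ x) = comulV (ι x))
    (act_ι : ∀ h x, ι (actQ h x) = actV h (ι x))
    (coact_ι : ∀ x, LinearMap.lTensor H ι (coactQ x) = coactV (ι x))
    (comul_mulQ : comulQ ∘ₗ TensorProduct.lift mulQ
      = ydTensorMul mulQ actQ coactQ ∘ₗ TensorProduct.map comulQ comulQ) :
    YDBialgebra k H Q :=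
  have hιι := TensorProduct.map_injective_of_field hι hι
  have counit_ι : ∀ x, (counitV ∘ₗ ι) x = counitV (ι x) := fun _ => rfl
  have counit_p : ∀ x, (counitV ∘ₗ ι) (p x) = S.counit (j x) := fun x => by
    rw [LinearMap.comp_apply, hιp, counit_π]
  { mul := mulQ
    one := p oneK
    comul := comulQ
    counit := counitV ∘ₗ ι
    act := actQ
    coact := coactQ
    mul_assoc' := by
      refine hp.forall₃.2 fun x y z => ?_
      have : mulK (mulK x y) z = mulK x (mulK y z) := hj (by simp only [mul_j, S.mul_assoc'])
      simp only [← mul_p, this]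
    one_mul' := by
      refine hp.forall.2 fun x => ?_
      rw [← mul_p, show mulK oneK x = x from hj (by rw [mul_j, one_j, S.one_mul'])]
    mul_one' := by
      refine hp.forall.2 fun x => ?_
      rw [← mul_p, show mulK x oneK = x from hj (by rw [mul_j, one_j, S.mul_one'])]
    act_one' := by
      refine hp.forall.2 fun x => ?_
      rw [← act_p, show actK 1 x = x from hj (by rw [act_j, S.act_one'])]
    act_mul' := fun g h => by
      refine hp.forall.2 fun x => ?_
      rw [← act_p, ← act_p, ← act_p, show actK (g * h) x = actK g (actK h x) from
        hj (by simp only [act_j, S.act_mul'])]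
    coassoc' := eq_of_injective_of_natural (TensorProduct.map_injective_of_field hι hιι)
      (coassoc_left_natural comul_ι) (coassoc_right_natural comul_ι) <|
      eq_of_surjective_of_natural hπ
        (coassoc_left_natural comul_π) (coassoc_right_natural comul_π) S.coassoc'
    counit_comul_left := fun x => hι <| by
      rw [counit_left_natural comul_ι counit_ι]
      obtain ⟨y, hy⟩ := hπ (ι x)
      rw [← hy, ← counit_left_natural comul_π counit_π, S.counit_comul_left]
    counit_comul_right := fun x => hι <| by
      rw [counit_right_natural comul_ι counit_ι]
      obtain ⟨y, hy⟩ := hπ (ι x)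
      rw [← hy, ← counit_right_natural comul_π counit_π, S.counit_comul_right]
    coact_coassoc := eq_of_injective_of_natural
      (Module.Flat.lTensor_preserves_injective_linearMap ι hι)
      (coact_coassoc_left_natural coact_ι) (coact_coassoc_right_natural coact_ι) <|
      eq_of_surjective_of_natural hπ
        (coact_coassoc_left_natural coact_π) (coact_coassoc_right_natural coact_π) S.coact_coassoc
    coact_counit := fun x => hι <| by
      rw [coact_counit_natural coact_ι]
      obtain ⟨y, hy⟩ := hπ (ι x)
      rw [← hy, ← coact_counit_natural coact_π, S.coact_counit]
    yd_compat := eq_of_injective_of_natural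
      (Module.Flat.lTensor_preserves_injective_linearMap ι hι)
      (coact_act_natural act_ι coact_ι) (ydCompatRHS_natural act_ι coact_ι) <|
      eq_of_surjective_of_natural (LinearMap.lTensor_surjective H hπ)
        (coact_act_natural act_π coact_π) (ydCompatRHS_natural act_π coact_π) S.yd_compat
    act_algebra := eq_of_surjective_of_natural
      (LinearMap.lTensor_surjective H (TensorProduct.map_surjective hp hp))
      (act_mul_natural mul_p act_p) (mul_act_natural mul_p act_p) <|
      eq_of_injective_of_natural hj
        (act_mul_natural mul_j act_j) (mul_act_natural mul_j act_j) S.act_algebra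
    act_one_elem := fun h => by
      rw [← act_p, ← map_smul, show actK h oneK = Coalgebra.counit (R := k) h • oneK from
        hj (by rw [act_j, map_smul, one_j, S.act_one_elem])]
    coact_algebra := eq_of_surjective_of_natural (TensorProduct.map_surjective hp hp)
      (coact_mul_natural mul_p coact_p) (mul_coact_natural mul_p coact_p) <|
      eq_of_injective_of_natural (Module.Flat.lTensor_preserves_injective_linearMap j hj)
        (coact_mul_natural mul_j coact_j) (mul_coact_natural mul_j coact_j) S.coact_algebra
    coact_one := by
      apply Module.Flat.lTensor_preserves_injective_linearMap (M := H) ι hι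
      rw [coact_ι, hιp, one_j, ← coact_π, S.coact_one, LinearMap.lTensor_tmul,
        LinearMap.lTensor_tmul, hιp, one_j]
    act_comul := eq_of_injective_of_natural hιι
      (comul_act_natural comul_ι act_ι) (act_comul_natural comul_ι act_ι) <|
      eq_of_surjective_of_natural (LinearMap.lTensor_surjective H hπ)
        (comul_act_natural comul_π act_π) (act_comul_natural comul_π act_π) S.act_comul
    act_counit := fun h => by
      refine hp.forall.2 fun x => ?_
      rw [← act_p, counit_p, counit_p, act_j, S.act_counit]
    coact_comul := eq_of_injective_of_natural
      (Module.Flat.lTensor_preserves_injective_linearMap _ hιι)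
      (comul_coact_natural comul_ι coact_ι) (coact_comul_natural comul_ι coact_ι) <|
      eq_of_surjective_of_natural hπ
        (comul_coact_natural comul_π coact_π) (coact_comul_natural comul_π coact_π) S.coact_comul
    coact_counit_elem := fun x => by
      rw [coact_counit_elem_natural counit_ι coact_ι, LinearMap.comp_apply]
      obtain ⟨y, hy⟩ := hπ (ι x)
      rw [← hy, ← coact_counit_elem_natural counit_π coact_π, S.coact_counit_elem, counit_π]
    counit_mul := by
      refine hp.forall₂.2 fun x y => ?_
      rw [← mul_p, counit_p, counit_p, counit_p, mul_j, S.counit_mul]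
    comul_one := hιι <| by
      rw [comul_ι, hιp, one_j, ← comul_π, S.comul_one, map_tmul, map_tmul, hιp, one_j]
    counit_one := by rw [counit_p, one_j, S.counit_one]
    braided_comul_mul := comul_mulQ }

end Quotient

/-- Proposition 2.1 of Grunenfelder–Heckenberger, as used in the paper: let `H` be a Hopf
algebra with bijective antipode, `B` a bialgebra in the category of Yetter–Drinfeld modules
over `H`, `K` a subalgebra of `B` and `I` a Yetter–Drinfeld submodule of `K` which is a
coideal of `B`, an ideal of `K`, and satisfies `Δ(K) ⊆ K ⊗ K + I ⊗ B`. Then `K/I` inherits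
from `B` a structure of bialgebra in the category of Yetter–Drinfeld modules over `H`, with
multiplication, unit, comultiplication and counit induced by those of `B`. -/
theorem yd_coideal_subalgebra_quotient {k H B : Type*} [Field k]
    [Ring H] [HopfAlgebra k H]
    (hS : Function.Bijective (HopfAlgebra.antipode (R := k) (A := H)))
    [AddCommGroup B] [Module k B] (S : YDBialgebra k H B)
    (K I : Submodule k B) (hIK : I ≤ K)
    -- `K` is a subalgebra of `B` and a Yetter–Drinfeld submodule
    (hKmul : ∀ x ∈ K, ∀ y ∈ K, S.mul x y ∈ K) (hKone : S.one ∈ K)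
    (hKact : ∀ (h : H), ∀ x ∈ K, S.act h x ∈ K)
    (hKcoact : ∀ x ∈ K, S.coact x ∈ LinearMap.range (LinearMap.lTensor H K.subtype))
    -- `I` is a Yetter–Drinfeld submodule
    (hIact : ∀ (h : H), ∀ x ∈ I, S.act h x ∈ I)
    (hIcoact : ∀ x ∈ I, S.coact x ∈ LinearMap.range (LinearMap.lTensor H I.subtype))
    -- `I` is an ideal of `K`
    (hIideal : ∀ x ∈ K, ∀ a ∈ I, S.mul x a ∈ I ∧ S.mul a x ∈ I)
    -- `I` is a coideal of `B`
    (hIcoideal : ∀ a ∈ I, S.comul a ∈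
      LinearMap.range (LinearMap.rTensor B I.subtype)
        ⊔ LinearMap.range (LinearMap.lTensor B I.subtype))
    (hIcounit : ∀ a ∈ I, S.counit a = 0)
    -- `Δ(K) ⊆ K ⊗ K + I ⊗ B`
    (hDeltaK : ∀ x ∈ K, S.comul x ∈
      LinearMap.range (TensorProduct.map K.subtype K.subtype)
        ⊔ LinearMap.range (LinearMap.rTensor B I.subtype)) :
    ∃ T : YDBialgebra k H (↥K ⧸ I.comap K.subtype),
      (∀ x y : K, T.mul ((I.comap K.subtype).mkQ x) ((I.comap K.subtype).mkQ y)
          = (I.comap K.subtype).mkQ ⟨S.mul x y, hKmul x x.2 y y.2⟩) ∧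
      T.one = (I.comap K.subtype).mkQ ⟨S.one, hKone⟩ ∧
      (∀ (h : H) (x : K), T.act h ((I.comap K.subtype).mkQ x)
          = (I.comap K.subtype).mkQ ⟨S.act h x, hKact h x x.2⟩) ∧
      (∀ (x : K) (t : ↥K ⊗[k] ↥K),
        S.comul x - TensorProduct.map K.subtype K.subtype t
            ∈ LinearMap.range (LinearMap.rTensor B I.subtype) →
        T.comul ((I.comap K.subtype).mkQ x)
          = TensorProduct.map (I.comap K.subtype).mkQ (I.comap K.subtype).mkQ t) ∧
      (∀ x : K, T.counit ((I.comap K.subtype).mkQ x) = S.counit x) := by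
  set p := (I.comap K.subtype).mkQ with hp_def
  have hp : Function.Surjective p := Submodule.mkQ_surjective _
  have hp0 : ∀ x : K, p x = 0 ↔ (x : B) ∈ I := fun x => by
    rw [hp_def, Submodule.mkQ_apply, Submodule.Quotient.mk_eq_zero]; rfl
  set π := I.mkQ with hπ_def
  have hπ : Function.Surjective π := Submodule.mkQ_surjective _
  have hπ0 : ∀ x, π x = 0 ↔ x ∈ I := fun x => by
    rw [hπ_def, Submodule.mkQ_apply, Submodule.Quotient.mk_eq_zero]
  have hπI : π ∘ₗ I.subtype = 0 := by
    ext x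
    exact (hπ0 x).2 x.2
  have hj : Function.Injective K.subtype := K.subtype_injective
  obtain ⟨ι, hιp⟩ := exists_desc_of_surjective p hp (π ∘ₗ K.subtype)
    fun x hx => (hπ0 x).2 ((hp0 x).1 hx)
  have hι : Function.Injective ι := by
    rw [injective_iff_map_eq_zero]
    refine hp.forall.2 fun x hx => ?_
    rw [hιp] at hx
    exact (hp0 x).2 ((hπ0 x).1 hx)
  have hιι := TensorProduct.map_injective_of_field hι hι
  have hHι := Module.Flat.lTensor_preserves_injective_linearMap (M := H) ι hι
  have hmap (t : ↥K ⊗[k] ↥K) : map ι ι (map p p t) = map π π (map K.subtype K.subtype t) := by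
    induction t with
    | zero => simp
    | add u v hu hv => simp only [map_add, hu, hv]
    | tmul u v => simp [hιp]
  have hHmap (t : H ⊗[k] ↥K) : LinearMap.lTensor H ι (LinearMap.lTensor H p t)
      = LinearMap.lTensor H π (LinearMap.lTensor H K.subtype t) := by
    induction t with
    | zero => simp
    | add u v hu hv => simp only [map_add, hu, hv]
    | tmul u v => simp [hιp]
  have hIB {t : B ⊗[k] B} (ht : t ∈ LinearMap.range (LinearMap.rTensor B I.subtype)) :
      map π π t = 0 := by
    obtain ⟨s, rfl⟩ := ht
    rw [← LinearMap.comp_apply, LinearMap.rTensor, ← map_comp, hπI, map_zero_left,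
      LinearMap.zero_apply]
  have hBI {t : B ⊗[k] B} (ht : t ∈ LinearMap.range (LinearMap.lTensor B I.subtype)) :
      map π π t = 0 := by
    obtain ⟨s, rfl⟩ := ht
    rw [← LinearMap.comp_apply, LinearMap.lTensor, ← map_comp, hπI, map_zero_right,
      LinearMap.zero_apply]
  have hHI {x : B} (hx : x ∈ I) : LinearMap.lTensor H π (S.coact x) = 0 := by
    obtain ⟨s, hs⟩ := hIcoact x hx
    rw [← hs, ← LinearMap.lTensor_comp_apply, hπI, LinearMap.lTensor_zero, LinearMap.zero_apply]
  -- the operations on `K`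
  let mulK : K →ₗ[k] K →ₗ[k] K := LinearMap.mk₂ k (fun x y => ⟨S.mul x y, hKmul x x.2 y y.2⟩)
    (fun _ _ _ => Subtype.ext (by simp)) (fun _ _ _ => Subtype.ext (by simp))
    (fun _ _ _ => Subtype.ext (by simp)) (fun _ _ _ => Subtype.ext (by simp))
  let actK : H →ₗ[k] K →ₗ[k] K := LinearMap.mk₂ k (fun h x => ⟨S.act h x, hKact h x x.2⟩)
    (fun _ _ _ => Subtype.ext (by simp)) (fun _ _ _ => Subtype.ext (by simp))
    (fun _ _ _ => Subtype.ext (by simp)) (fun _ _ _ => Subtype.ext (by simp))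
  have mul_j : ∀ x y, K.subtype (mulK x y) = S.mul (K.subtype x) (K.subtype y) := fun _ _ => rfl
  have act_j : ∀ h x, K.subtype (actK h x) = S.act h (K.subtype x) := fun _ _ => rfl
  obtain ⟨coactK, coact_j⟩ := exists_lift_of_injective (LinearMap.lTensor H K.subtype)
    (Module.Flat.lTensor_preserves_injective_linearMap _ hj) (S.coact ∘ₗ K.subtype)
    fun x => hKcoact x x.2
  -- the operations on `B ⧸ I`
  obtain ⟨actV', act_π⟩ := exists_desc_of_surjective π hπ (S.act.compr₂ π).flip fun x hx => by
    ext h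
    exact (hπ0 _).2 (hIact h x ((hπ0 x).1 hx))
  obtain ⟨coactV, coact_π⟩ := exists_desc_of_surjective π hπ (LinearMap.lTensor H π ∘ₗ S.coact)
    fun x hx => hHI ((hπ0 x).1 hx)
  obtain ⟨comulV, comul_π⟩ := exists_desc_of_surjective π hπ (map π π ∘ₗ S.comul) fun x hx => by
    obtain ⟨u, hu, v, hv, huv⟩ := Submodule.mem_sup.1 (hIcoideal x ((hπ0 x).1 hx))
    rw [LinearMap.comp_apply, ← huv, map_add, hIB hu, hBI hv, add_zero]
  obtain ⟨counitV, counit_π⟩ := exists_desc_of_surjective π hπ S.counit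
    fun x hx => hIcounit x ((hπ0 x).1 hx)
  -- the operations on `K / I`
  obtain ⟨mulQ', mul_p'⟩ := exists_desc_of_surjective p hp (mulK.compr₂ p) fun x hx => by
    ext y
    exact (hp0 _).2 (hIideal y y.2 x ((hp0 x).1 hx)).2
  obtain ⟨mulQ, mul_p⟩ := exists_desc_of_surjective p hp mulQ'.flip fun y hy => by
    refine LinearMap.ext (hp.forall.2 fun x => ?_)
    rw [LinearMap.flip_apply, mul_p']
    exact (hp0 _).2 (hIideal x x.2 y ((hp0 y).1 hy)).1
  obtain ⟨actQ, act_p⟩ := exists_desc_of_surjective p hp (actK.compr₂ p).flip fun x hx => by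
    ext h
    exact (hp0 _).2 (hIact h x ((hp0 x).1 hx))
  obtain ⟨coactQ, coact_p⟩ := exists_desc_of_surjective p hp (LinearMap.lTensor H p ∘ₗ coactK)
    fun x hx => hHι <| by
      rw [LinearMap.comp_apply, hHmap, coact_j, map_zero]
      exact hHI ((hp0 x).1 hx)
  have exists_rep (x : K) : ∃ t : ↥K ⊗[k] ↥K, S.comul x - map K.subtype K.subtype t
      ∈ LinearMap.range (LinearMap.rTensor B I.subtype) := by
    obtain ⟨u, ⟨t, rfl⟩, v, hv, huv⟩ := Submodule.mem_sup.1 (hDeltaK x x.2)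
    exact ⟨t, by rwa [← huv, add_sub_cancel_left]⟩
  have comul_rep (x : K) (t : ↥K ⊗[k] ↥K) (h : S.comul x - map K.subtype K.subtype t
      ∈ LinearMap.range (LinearMap.rTensor B I.subtype)) :
      map ι ι (map p p t) = comulV (ι (p x)) := by
    have := hIB h
    rw [map_sub, sub_eq_zero] at this
    rw [hmap, hιp, ← this]
    exact (comul_π x).symm
  obtain ⟨comulQ, comul_ι⟩ := exists_lift_of_injective (map ι ι) hιι (comulV ∘ₗ ι) <|
    hp.forall.2 fun x => by
      obtain ⟨t, ht⟩ := exists_rep x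
      exact ⟨_, comul_rep x t ht⟩
  have comul_p (x : K) (t : ↥K ⊗[k] ↥K) (h : S.comul x - map K.subtype K.subtype t
      ∈ LinearMap.range (LinearMap.rTensor B I.subtype)) : comulQ (p x) = map p p t :=
    hιι (by rw [comul_ι, comul_rep x t h, LinearMap.comp_apply])
  have mul_p₂ : ∀ x y, p (mulK x y) = mulQ.flip (p x) (p y) := fun x y => by
    rw [LinearMap.flip_apply, mul_p, LinearMap.flip_apply, mul_p', LinearMap.compr₂_apply]
  have act_p₂ : ∀ h x, p (actK h x) = actQ.flip h (p x) := fun h x => by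
    rw [LinearMap.flip_apply, act_p, LinearMap.flip_apply, LinearMap.compr₂_apply]
  have coact_p₂ : ∀ x, LinearMap.lTensor H p (coactK x) = coactQ (p x) := fun x =>
    (coact_p x).symm
  have comul_mulQ : comulQ ∘ₗ TensorProduct.lift mulQ.flip
      = ydTensorMul mulQ.flip actQ.flip coactQ ∘ₗ map comulQ comulQ := by
    refine TensorProduct.ext' (hp.forall₂.2 fun x y => ?_)
    obtain ⟨t, ht⟩ := exists_rep x
    obtain ⟨s, hs⟩ := exists_rep y
    rw [LinearMap.comp_apply, LinearMap.comp_apply, lift.tmul, map_tmul, ← mul_p₂, comul_p x t ht,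
      comul_p y s hs, ← ydTensorMul_natural mul_p₂ act_p₂ coact_p₂]
    apply comul_p
    rw [ydTensorMul_natural mul_j act_j coact_j]
    have hxy : S.comul (mulK x y)
        = ydTensorMul S.mul S.act S.coact (S.comul x ⊗ₜ S.comul y) := by
      exact LinearMap.congr_fun S.braided_comul_mul ((x : B) ⊗ₜ (y : B))
    have hKK (t : ↥K ⊗[k] ↥K) : map K.subtype K.subtype t
        ∈ LinearMap.range (LinearMap.rTensor B K.subtype) := by
      rw [← LinearMap.rTensor_comp_lTensor]
      exact ⟨_, rfl⟩
    have hIK' : LinearMap.range (LinearMap.rTensor B I.subtype)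
        ≤ LinearMap.range (LinearMap.rTensor B K.subtype) := by
      rintro _ ⟨u, rfl⟩
      refine ⟨LinearMap.rTensor B (Submodule.inclusion hIK) u, ?_⟩
      rw [← LinearMap.rTensor_comp_apply, Submodule.subtype_comp_inclusion]
    have hyK : S.comul y ∈ LinearMap.range (LinearMap.rTensor B K.subtype) := by
      simpa using add_mem (hIK' hs) (hKK s)
    have hsplit (a b c d : B ⊗[k] B) :
        a ⊗ₜ[k] b - c ⊗ₜ[k] d = (a - c) ⊗ₜ[k] b + c ⊗ₜ[k] (b - d) := by
      rw [sub_tmul, tmul_sub]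
      abel
    rw [hxy, ← map_sub, hsplit, map_add]
    exact add_mem
      (ydTensorMul_mem_range_rTensor _ _ _ I K I
        (fun a ha g c hc => (hIideal _ (hKact g c hc) a ha).2) ht hyK)
      (ydTensorMul_mem_range_rTensor _ _ _ K I I
        (fun a ha g c hc => (hIideal a ha _ (hIact g c hc)).1) (hKK t) hs)
  refine ⟨S.ofSubquotient (oneK := ⟨S.one, hKone⟩) (actV := actV'.flip) hj hp hπ hι hιp
    mulQ.flip comulQ actQ.flip coactQ mul_j rfl act_j coact_j mul_p₂ act_p₂ coact_p₂
    (fun x => (comul_π x).symm) (fun x => (counit_π x).symm)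
    (fun h x => (LinearMap.congr_fun (act_π x) h).symm) (fun x => (coact_π x).symm)
    comul_ι ?_ ?_ comul_mulQ, fun x y => (mul_p₂ x y).symm, rfl, fun h x => (act_p₂ h x).symm,
    comul_p, fun x => ?_⟩
  · refine fun h => hp.forall.2 fun x => ?_
    rw [← act_p₂, hιp, hιp]
    exact (LinearMap.congr_fun (act_π x) h).symm
  · refine hp.forall.2 fun x => ?_
    rw [coact_p, LinearMap.comp_apply, hHmap, coact_j, hιp]
    exact (coact_π x).symm
  · exact (congrArg counitV (hιp x)).trans (counit_π x)
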